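/- Let 𝖠 = A_sym, let v,u ∈ V with even geodesic distance r = d_G(v,u) > 0, let q ≥ 1 be the number of paths of length r in G between v and u, and let the MPNN depth be m = r/2 with |σ'|≤1 and |σ''|≤1. If the MPNN generates mixing M > 0 among v and u, i.e. there exist an input X and coordinates 1≤α,β≤d with |∂²y^{(m)}(X)/∂x_v^α∂x_u^β| ≥ M, then the weight bound satisfies w ≥ (d_min/c₂)·(M/q)^{1/r}, where d_min is the minimal degree of G. -/

import Mathlib

open scoped BigOperators

noncomputable section

namespace OSQ

variable {n d : ℕ}

/-- componentwise application of the activation function. -/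
def act (σ : ℝ → ℝ) (x : EuclideanSpace ℝ (Fin d)) : EuclideanSpace ℝ (Fin d) :=
  WithLp.toLp 2 (fun i => σ (x i))

/-- node features computed by the MPNN after `t` layers. -/
def mpnn (σ : ℝ → ℝ) (𝒜 : Matrix (Fin n) (Fin n) ℝ)
    (Ω W : ℕ → EuclideanSpace ℝ (Fin d) →L[ℝ] EuclideanSpace ℝ (Fin d))
    (ψ : ℕ → EuclideanSpace ℝ (Fin d) × EuclideanSpace ℝ (Fin d) → EuclideanSpace ℝ (Fin d)) :
    ℕ → (Fin n → EuclideanSpace ℝ (Fin d)) → Fin n → EuclideanSpace ℝ (Fin d)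
  | 0, X, v => X v
  | (t+1), X, v =>
    act σ (Ω (t+1) (mpnn σ 𝒜 Ω W ψ t X v)
      + W (t+1) (∑ u : Fin n, 𝒜 v u • ψ (t+1) (mpnn σ 𝒜 Ω W ψ t X v, mpnn σ 𝒜 Ω W ψ t X u)))

/-- coordinate direction in the input space: a perturbation of entry `β` of the
feature of node `u`. -/
def dir (u : Fin n) (β : Fin d) : Fin n → EuclideanSpace ℝ (Fin d) :=
  Pi.single u (EuclideanSpace.single β 1)

/-- `∂ h_v^{(m),α} / ∂ x_u^β`. -/
def jacEntry (σ : ℝ → ℝ) (𝒜 : Matrix (Fin n) (Fin n) ℝ)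
    (Ω W : ℕ → EuclideanSpace ℝ (Fin d) →L[ℝ] EuclideanSpace ℝ (Fin d))
    (ψ : ℕ → EuclideanSpace ℝ (Fin d) × EuclideanSpace ℝ (Fin d) → EuclideanSpace ℝ (Fin d))
    (m : ℕ) (v u : Fin n) (X : Fin n → EuclideanSpace ℝ (Fin d)) (α β : Fin d) : ℝ :=
  fderiv ℝ (fun Y => mpnn σ 𝒜 Ω W ψ m Y v α) X (dir u β)

/-- `∂² h_i^{(m),α} / ∂ x_v^β ∂ x_u^γ`. -/
def hessEntry (σ : ℝ → ℝ) (𝒜 : Matrix (Fin n) (Fin n) ℝ)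
    (Ω W : ℕ → EuclideanSpace ℝ (Fin d) →L[ℝ] EuclideanSpace ℝ (Fin d))
    (ψ : ℕ → EuclideanSpace ℝ (Fin d) × EuclideanSpace ℝ (Fin d) → EuclideanSpace ℝ (Fin d))
    (m : ℕ) (i v u : Fin n) (X : Fin n → EuclideanSpace ℝ (Fin d)) (α β γ : Fin d) : ℝ :=
  fderiv ℝ (fun Y => fderiv ℝ (fun Z => mpnn σ 𝒜 Ω W ψ m Z i α) Y (dir u γ)) X (dir v β)

/-- graph-level prediction with SUM readout: `y(X) = θᵀ Σ_v h_v^{(m)}`. -/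
def readout (θ : EuclideanSpace ℝ (Fin d)) (σ : ℝ → ℝ) (𝒜 : Matrix (Fin n) (Fin n) ℝ)
    (Ω W : ℕ → EuclideanSpace ℝ (Fin d) →L[ℝ] EuclideanSpace ℝ (Fin d))
    (ψ : ℕ → EuclideanSpace ℝ (Fin d) × EuclideanSpace ℝ (Fin d) → EuclideanSpace ℝ (Fin d))
    (m : ℕ) (X : Fin n → EuclideanSpace ℝ (Fin d)) : ℝ :=
  ∑ α : Fin d, θ α * (∑ v : Fin n, mpnn σ 𝒜 Ω W ψ m X v) α

/-- `∂² y^{(m)} / ∂ x_v^α ∂ x_u^β`. -/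
def mixEntry (θ : EuclideanSpace ℝ (Fin d)) (σ : ℝ → ℝ) (𝒜 : Matrix (Fin n) (Fin n) ℝ)
    (Ω W : ℕ → EuclideanSpace ℝ (Fin d) →L[ℝ] EuclideanSpace ℝ (Fin d))
    (ψ : ℕ → EuclideanSpace ℝ (Fin d) × EuclideanSpace ℝ (Fin d) → EuclideanSpace ℝ (Fin d))
    (m : ℕ) (v u : Fin n) (X : Fin n → EuclideanSpace ℝ (Fin d)) (α β : Fin d) : ℝ :=
  fderiv ℝ (fun Y => fderiv ℝ (fun Z => readout θ σ 𝒜 Ω W ψ m Z) Y (dir u β)) X (dir v α)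

/-- the matrix `S := (ω/w)I + c₁ diag(𝒜 1) + c₂ 𝒜`. -/
def Smat (ω w c₁ c₂ : ℝ) (𝒜 : Matrix (Fin n) (Fin n) ℝ) : Matrix (Fin n) (Fin n) ℝ :=
  (ω / w) • (1 : Matrix (Fin n) (Fin n) ℝ)
    + c₁ • Matrix.diagonal (fun i => ∑ j, 𝒜 i j) + c₂ • 𝒜

/-- `diag(𝒜 1)` : the diagonal matrix of row sums. -/
def rowSumDiag (𝒜 : Matrix (Fin n) (Fin n) ℝ) : Matrix (Fin n) (Fin n) ℝ :=
  Matrix.diagonal (fun i => ∑ j, 𝒜 i j)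

/-- `diag(1ᵀ M)` : the diagonal matrix of column sums. -/
def colSumDiag (M : Matrix (Fin n) (Fin n) ℝ) : Matrix (Fin n) (Fin n) ℝ :=
  Matrix.diagonal (fun j => ∑ i, M i j)

/-- the operator (spectral) norm of a matrix, viewed as a linear map between
Euclidean spaces. -/
def matOpNorm {ι κ : Type*} [Fintype ι] [Fintype κ] [DecidableEq ι] (M : Matrix κ ι ℝ) : ℝ :=
  ‖LinearMap.toContinuousLinearMap (Matrix.toEuclideanLin M)‖


/-- the symmetrically-normalized adjacency matrix `A_sym := D^{-1/2} A D^{-1/2}`. -/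
def Asym (G : SimpleGraph (Fin n)) [DecidableRel G.Adj] : Matrix (Fin n) (Fin n) ℝ :=
  Matrix.diagonal (fun a => (Real.sqrt (G.degree a))⁻¹) * G.adjMatrix ℝ *
    Matrix.diagonal (fun a => (Real.sqrt (G.degree a))⁻¹)

/-- the random-walk normalized adjacency matrix `D^{-1} A`. -/
def Arw (G : SimpleGraph (Fin n)) [DecidableRel G.Adj] : Matrix (Fin n) (Fin n) ℝ :=
  Matrix.diagonal (fun a => ((G.degree a : ℝ))⁻¹) * G.adjMatrix ℝ

/-- perturbation supported at one node. -/
abbrev sgl (a : Fin n) (ξ : EuclideanSpace ℝ (Fin d)) : Fin n → EuclideanSpace ℝ (Fin d) :=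
  Pi.single a ξ

/-- pre-activation of layer `t+1`. -/
def pre (σ : ℝ → ℝ) (𝒜 : Matrix (Fin n) (Fin n) ℝ)
    (Ω W : ℕ → EuclideanSpace ℝ (Fin d) →L[ℝ] EuclideanSpace ℝ (Fin d))
    (ψ : ℕ → EuclideanSpace ℝ (Fin d) × EuclideanSpace ℝ (Fin d) → EuclideanSpace ℝ (Fin d))
    (t : ℕ) (X : Fin n → EuclideanSpace ℝ (Fin d)) (v : Fin n) : EuclideanSpace ℝ (Fin d) :=
  Ω (t+1) (mpnn σ 𝒜 Ω W ψ t X v)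
      + W (t+1) (∑ u : Fin n, 𝒜 v u • ψ (t+1) (mpnn σ 𝒜 Ω W ψ t X v, mpnn σ 𝒜 Ω W ψ t X u))

theorem mpnn_succ_apply (σ : ℝ → ℝ) (𝒜 : Matrix (Fin n) (Fin n) ℝ)
    (Ω W : ℕ → EuclideanSpace ℝ (Fin d) →L[ℝ] EuclideanSpace ℝ (Fin d))
    (ψ : ℕ → EuclideanSpace ℝ (Fin d) × EuclideanSpace ℝ (Fin d) → EuclideanSpace ℝ (Fin d))
    (t : ℕ) (X : Fin n → EuclideanSpace ℝ (Fin d)) (v : Fin n) (α : Fin d) :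
    mpnn σ 𝒜 Ω W ψ (t+1) X v α = σ (pre σ 𝒜 Ω W ψ t X v α) := rfl

theorem contDiff_pre_of (σ : ℝ → ℝ) (𝒜 : Matrix (Fin n) (Fin n) ℝ)
    (Ω W : ℕ → EuclideanSpace ℝ (Fin d) →L[ℝ] EuclideanSpace ℝ (Fin d))
    (ψ : ℕ → EuclideanSpace ℝ (Fin d) × EuclideanSpace ℝ (Fin d) → EuclideanSpace ℝ (Fin d))
    (hψ : ∀ t, ContDiff ℝ 2 (ψ t)) (t : ℕ)
    (h : ∀ i, ContDiff ℝ 2 (fun X => mpnn σ 𝒜 Ω W ψ t X i)) (i : Fin n) :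
    ContDiff ℝ 2 (fun X => pre σ 𝒜 Ω W ψ t X i) := by
  unfold pre
  refine ((Ω (t+1)).contDiff.comp (h i)).add ((W (t+1)).contDiff.comp ?_)
  refine ContDiff.sum fun j _ => ?_
  exact ContDiff.const_smul (𝒜 i j) ((hψ (t+1)).comp ((h i).prodMk (h j)))

theorem contDiff_mpnn (σ : ℝ → ℝ) (hσ : ContDiff ℝ 2 σ) (𝒜 : Matrix (Fin n) (Fin n) ℝ)
    (Ω W : ℕ → EuclideanSpace ℝ (Fin d) →L[ℝ] EuclideanSpace ℝ (Fin d))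
    (ψ : ℕ → EuclideanSpace ℝ (Fin d) × EuclideanSpace ℝ (Fin d) → EuclideanSpace ℝ (Fin d))
    (hψ : ∀ t, ContDiff ℝ 2 (ψ t)) (t : ℕ) :
    ∀ i, ContDiff ℝ 2 (fun X => mpnn σ 𝒜 Ω W ψ t X i) := by
  induction t with
  | zero => intro i; exact contDiff_apply ℝ (EuclideanSpace ℝ (Fin d)) i
  | succ t ih =>
    intro i
    have h := contDiff_pre_of σ 𝒜 Ω W ψ hψ t ih i
    rw [contDiff_euclidean] at h ⊢
    intro α
    exact hσ.comp (h α)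

theorem contDiff_pre (σ : ℝ → ℝ) (hσ : ContDiff ℝ 2 σ) (𝒜 : Matrix (Fin n) (Fin n) ℝ)
    (Ω W : ℕ → EuclideanSpace ℝ (Fin d) →L[ℝ] EuclideanSpace ℝ (Fin d))
    (ψ : ℕ → EuclideanSpace ℝ (Fin d) × EuclideanSpace ℝ (Fin d) → EuclideanSpace ℝ (Fin d))
    (hψ : ∀ t, ContDiff ℝ 2 (ψ t)) (t : ℕ) (i : Fin n) :
    ContDiff ℝ 2 (fun X => pre σ 𝒜 Ω W ψ t X i) :=
  contDiff_pre_of σ 𝒜 Ω W ψ hψ t (contDiff_mpnn σ hσ 𝒜 Ω W ψ hψ t) i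

theorem mpnn_local (G : SimpleGraph (Fin n)) (hconn : G.Connected)
    (σ : ℝ → ℝ) (𝒜 : Matrix (Fin n) (Fin n) ℝ)
    (hA : ∀ i j, 𝒜 i j ≠ 0 → G.Adj i j)
    (Ω W : ℕ → EuclideanSpace ℝ (Fin d) →L[ℝ] EuclideanSpace ℝ (Fin d))
    (ψ : ℕ → EuclideanSpace ℝ (Fin d) × EuclideanSpace ℝ (Fin d) → EuclideanSpace ℝ (Fin d))
    (a : Fin n) (ξ : EuclideanSpace ℝ (Fin d)) (s : ℝ)
    (Y : Fin n → EuclideanSpace ℝ (Fin d)) (t : ℕ) :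
    ∀ i, t < G.dist i a →
      mpnn σ 𝒜 Ω W ψ t (Y + s • sgl a ξ) i = mpnn σ 𝒜 Ω W ψ t Y i := by
  induction t with
  | zero =>
    intro i hi
    have hne : i ≠ a := by rintro rfl; simp at hi
    simp [mpnn, hne]
  | succ t ih =>
    intro i hi
    have h1 := ih i (by omega)
    simp only [mpnn]
    rw [h1]
    congr 3
    refine Finset.sum_congr rfl fun j _ => ?_
    by_cases hj : 𝒜 i j = 0
    · simp [hj]
    · have hadj := hA i j hj
      have h2 : G.dist i a ≤ G.dist i j + G.dist j a := hconn.dist_triangle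
      have h3 : G.dist i j = 1 := SimpleGraph.dist_eq_one_iff_adj.mpr hadj
      rw [ih j (by omega)]

theorem norm_le_of_coord (x y : EuclideanSpace ℝ (Fin d)) (h : ∀ i, |x i| ≤ |y i|) :
    ‖x‖ ≤ ‖y‖ := by
  rw [EuclideanSpace.norm_eq, EuclideanSpace.norm_eq]
  apply Real.sqrt_le_sqrt
  refine Finset.sum_le_sum fun i _ => ?_
  rw [Real.norm_eq_abs, Real.norm_eq_abs]
  exact pow_le_pow_left₀ (abs_nonneg _) (h i) 2

theorem hasDerivAt_line {E F : Type*} [NormedAddCommGroup E] [NormedSpace ℝ E]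
    [NormedAddCommGroup F] [NormedSpace ℝ F] {f : E → F} {Y : E}
    (hf : DifferentiableAt ℝ f Y) (e : E) :
    HasDerivAt (fun s : ℝ => f (Y + s • e)) (fderiv ℝ f Y e) 0 :=
  hf.hasFDerivAt.hasLineDerivAt e

theorem fderiv_coord {E : Type*} [NormedAddCommGroup E] [NormedSpace ℝ E]
    {f : E → EuclideanSpace ℝ (Fin d)} {Y : E} (hf : DifferentiableAt ℝ f Y) (e : E) (i : Fin d) :
    fderiv ℝ (fun x => f x i) Y e = fderiv ℝ f Y e i := by
  have h := ((EuclideanSpace.proj i : EuclideanSpace ℝ (Fin d) →L[ℝ] ℝ).hasFDerivAt).comp Y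
    hf.hasFDerivAt
  have h2 : HasFDerivAt (fun x => f x i)
    ((EuclideanSpace.proj i : EuclideanSpace ℝ (Fin d) →L[ℝ] ℝ).comp (fderiv ℝ f Y)) Y := h
  rw [h2.fderiv]
  rfl

theorem fderiv_mpnn_coord (σ : ℝ → ℝ) (hσ : ContDiff ℝ 2 σ) (𝒜 : Matrix (Fin n) (Fin n) ℝ)
    (Ω W : ℕ → EuclideanSpace ℝ (Fin d) →L[ℝ] EuclideanSpace ℝ (Fin d))
    (ψ : ℕ → EuclideanSpace ℝ (Fin d) × EuclideanSpace ℝ (Fin d) → EuclideanSpace ℝ (Fin d))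
    (hψ : ∀ t, ContDiff ℝ 2 (ψ t)) (t : ℕ) (i : Fin n)
    (Y e : Fin n → EuclideanSpace ℝ (Fin d)) (α : Fin d) :
    fderiv ℝ (fun X => mpnn σ 𝒜 Ω W ψ (t+1) X i) Y e α =
      deriv σ (pre σ 𝒜 Ω W ψ t Y i α) * fderiv ℝ (fun X => pre σ 𝒜 Ω W ψ t X i) Y e α := by
  have hm := ((contDiff_mpnn σ hσ 𝒜 Ω W ψ hψ (t+1) i).differentiable (by norm_num)) Y
  have hp := ((contDiff_pre σ hσ 𝒜 Ω W ψ hψ t i).differentiable (by norm_num)) Y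
  rw [← fderiv_coord hm, ← fderiv_coord hp]
  have hs : HasDerivAt σ (deriv σ (pre σ 𝒜 Ω W ψ t Y i α)) (pre σ 𝒜 Ω W ψ t Y i α) :=
    ((hσ.differentiable (by norm_num)) _).hasDerivAt
  have hpc : DifferentiableAt ℝ (fun X => pre σ 𝒜 Ω W ψ t X i α) Y :=
    (differentiableAt_euclidean.mp hp) α
  have := hs.comp_hasFDerivAt Y hpc.hasFDerivAt
  have h2 : HasFDerivAt (fun X => mpnn σ 𝒜 Ω W ψ (t+1) X i α)
    (deriv σ (pre σ 𝒜 Ω W ψ t Y i α) • fderiv ℝ (fun X => pre σ 𝒜 Ω W ψ t X i α) Y) Y := this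
  rw [h2.fderiv]
  rfl

theorem norm_fderiv_pre_le_of (G : SimpleGraph (Fin n)) (hconn : G.Connected)
    (σ : ℝ → ℝ) (hσ : ContDiff ℝ 2 σ) (𝒜 : Matrix (Fin n) (Fin n) ℝ)
    (hA : ∀ i j, 𝒜 i j ≠ 0 → G.Adj i j) (hA0 : ∀ i j, 0 ≤ 𝒜 i j)
    (Ω W : ℕ → EuclideanSpace ℝ (Fin d) →L[ℝ] EuclideanSpace ℝ (Fin d))
    (w : ℝ) (hw : 0 < w) (hW : ∀ t, ‖W t‖ ≤ w)
    (ψ : ℕ → EuclideanSpace ℝ (Fin d) × EuclideanSpace ℝ (Fin d) → EuclideanSpace ℝ (Fin d))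
    (hψ : ∀ t, ContDiff ℝ 2 (ψ t)) (c₂ : ℝ) (hc₂ : 0 < c₂)
    (hψ₂ : ∀ t x y, ‖fderiv ℝ (fun z => ψ t (x, z)) y‖ ≤ c₂)
    (a : Fin n) (ξ : EuclideanSpace ℝ (Fin d)) (Y : Fin n → EuclideanSpace ℝ (Fin d)) (t : ℕ)
    (B : Fin n → ℝ)
    (hB : ∀ j, t ≤ G.dist j a →
      ‖fderiv ℝ (fun X => mpnn σ 𝒜 Ω W ψ t X j) Y (sgl a ξ)‖ ≤ B j)
    (i : Fin n) (hi : t + 1 ≤ G.dist i a) :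
    ‖fderiv ℝ (fun X => pre σ 𝒜 Ω W ψ t X i) Y (sgl a ξ)‖
      ≤ w * c₂ * ∑ j, 𝒜 i j * B j := by
  set e : Fin n → EuclideanSpace ℝ (Fin d) := sgl a ξ with he
  have hm := fun j => ((contDiff_mpnn σ hσ 𝒜 Ω W ψ hψ t j).differentiable (by norm_num)) Y
  have hp := ((contDiff_pre σ hσ 𝒜 Ω W ψ hψ t i).differentiable (by norm_num)) Y
  have hloc : ∀ s : ℝ, mpnn σ 𝒜 Ω W ψ t (Y + s • e) i = mpnn σ 𝒜 Ω W ψ t Y i := fun s =>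
    mpnn_local G hconn σ 𝒜 hA Ω W ψ a ξ s Y t i (by omega)
  set D : Fin n → EuclideanSpace ℝ (Fin d) := fun j =>
    fderiv ℝ (fun z => ψ (t+1) (mpnn σ 𝒜 Ω W ψ t Y i, z)) (mpnn σ 𝒜 Ω W ψ t Y j)
      (fderiv ℝ (fun X => mpnn σ 𝒜 Ω W ψ t X j) Y e) with hD
  have hterm : ∀ j, HasDerivAt (fun s : ℝ => ψ (t+1) (mpnn σ 𝒜 Ω W ψ t Y i,
      mpnn σ 𝒜 Ω W ψ t (Y + s • e) j)) (D j) 0 := by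
    intro j
    have h1 : Differentiable ℝ (fun z => ψ (t+1) (mpnn σ 𝒜 Ω W ψ t Y i, z)) :=
      ((hψ (t+1)).differentiable (by norm_num)).comp
        ((differentiable_const _).prodMk differentiable_id)
    have h2 := hasDerivAt_line (hm j) e
    have h3 := (h1 (mpnn σ 𝒜 Ω W ψ t Y j)).hasFDerivAt
    exact HasFDerivAt.comp_hasDerivAt_of_eq (x := (0:ℝ)) h3 h2 (by simp)
  have hall : HasDerivAt (fun s : ℝ => pre σ 𝒜 Ω W ψ t (Y + s • e) i)
      (W (t+1) (∑ j, 𝒜 i j • D j)) 0 := by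
    have h1 : HasDerivAt (fun s : ℝ => ∑ j, 𝒜 i j • ψ (t+1) (mpnn σ 𝒜 Ω W ψ t Y i,
      mpnn σ 𝒜 Ω W ψ t (Y + s • e) j)) (∑ j, 𝒜 i j • D j) 0 :=
      HasDerivAt.fun_sum fun j _ => (hterm j).const_smul (𝒜 i j)
    have h2 := ((W (t+1)).hasFDerivAt.comp_hasDerivAt (0:ℝ) h1).const_add
      (Ω (t+1) (mpnn σ 𝒜 Ω W ψ t Y i))
    have h3 : (fun s : ℝ => pre σ 𝒜 Ω W ψ t (Y + s • e) i) = fun s : ℝ =>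
        Ω (t+1) (mpnn σ 𝒜 Ω W ψ t Y i) + W (t+1) (∑ j, 𝒜 i j • ψ (t+1)
          (mpnn σ 𝒜 Ω W ψ t Y i, mpnn σ 𝒜 Ω W ψ t (Y + s • e) j)) := by
      funext s
      simp only [pre, hloc s]
    rw [h3]
    exact h2
  rw [(hasDerivAt_line hp e).unique hall]
  have hs : ‖∑ j, 𝒜 i j • D j‖ ≤ c₂ * ∑ j, 𝒜 i j * B j := by
    rw [Finset.mul_sum]
    refine (norm_sum_le _ _).trans (Finset.sum_le_sum fun j _ => ?_)
    rw [norm_smul, Real.norm_eq_abs, abs_of_nonneg (hA0 i j)]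
    by_cases hj : 𝒜 i j = 0
    · simp [hj]
    · have h2 : G.dist i a ≤ G.dist i j + G.dist j a := hconn.dist_triangle
      have h3 : G.dist i j = 1 := SimpleGraph.dist_eq_one_iff_adj.mpr (hA i j hj)
      have h4 := hB j (by omega)
      have h5 : ‖D j‖ ≤ c₂ * B j :=
        (ContinuousLinearMap.le_of_opNorm_le _ (hψ₂ _ _ _) _).trans
          (mul_le_mul_of_nonneg_left h4 hc₂.le)
      calc 𝒜 i j * ‖D j‖ ≤ 𝒜 i j * (c₂ * B j) := mul_le_mul_of_nonneg_left h5 (hA0 i j)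
        _ = _ := by ring
  calc _ ≤ w * ‖∑ j, 𝒜 i j • D j‖ := ContinuousLinearMap.le_of_opNorm_le _ (hW _) _
    _ ≤ w * (c₂ * ∑ j, 𝒜 i j * B j) := mul_le_mul_of_nonneg_left hs hw.le
    _ = _ := by ring

theorem norm_fderiv_mpnn_le (G : SimpleGraph (Fin n)) (hconn : G.Connected)
    (σ : ℝ → ℝ) (hσ : ContDiff ℝ 2 σ) (hσ' : ∀ x, |deriv σ x| ≤ 1)
    (𝒜 : Matrix (Fin n) (Fin n) ℝ)
    (hA : ∀ i j, 𝒜 i j ≠ 0 → G.Adj i j) (hA0 : ∀ i j, 0 ≤ 𝒜 i j)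
    (Ω W : ℕ → EuclideanSpace ℝ (Fin d) →L[ℝ] EuclideanSpace ℝ (Fin d))
    (w : ℝ) (hw : 0 < w) (hW : ∀ t, ‖W t‖ ≤ w)
    (ψ : ℕ → EuclideanSpace ℝ (Fin d) × EuclideanSpace ℝ (Fin d) → EuclideanSpace ℝ (Fin d))
    (hψ : ∀ t, ContDiff ℝ 2 (ψ t)) (c₂ : ℝ) (hc₂ : 0 < c₂)
    (hψ₂ : ∀ t x y, ‖fderiv ℝ (fun z => ψ t (x, z)) y‖ ≤ c₂)
    (a : Fin n) (ξ : EuclideanSpace ℝ (Fin d)) (hξ : ‖ξ‖ ≤ 1)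
    (Y : Fin n → EuclideanSpace ℝ (Fin d)) (t : ℕ) :
    ∀ i, t ≤ G.dist i a →
      ‖fderiv ℝ (fun X => mpnn σ 𝒜 Ω W ψ t X i) Y (sgl a ξ)‖
        ≤ (w * c₂) ^ t * (𝒜 ^ t) i a := by
  induction t with
  | zero =>
    intro i _
    have h : HasFDerivAt (fun X : Fin n → EuclideanSpace ℝ (Fin d) => mpnn σ 𝒜 Ω W ψ 0 X i)
        (ContinuousLinearMap.proj (R := ℝ)
        (φ := fun _ : Fin n => EuclideanSpace ℝ (Fin d)) i) Y := by
      exact (ContinuousLinearMap.proj (R := ℝ)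
        (φ := fun _ : Fin n => EuclideanSpace ℝ (Fin d)) i).hasFDerivAt
    rw [h.fderiv]
    by_cases hia : i = a
    · subst hia; simpa using hξ
    · simp [hia]
  | succ t ih =>
    intro i hi
    have h := norm_fderiv_pre_le_of G hconn σ hσ 𝒜 hA hA0 Ω W w hw hW ψ hψ c₂ hc₂ hψ₂ a ξ Y t
      _ ih i hi
    refine (norm_le_of_coord _ _ fun α => ?_).trans (h.trans (le_of_eq ?_))
    · rw [fderiv_mpnn_coord σ hσ 𝒜 Ω W ψ hψ, abs_mul]
      exact mul_le_of_le_one_left (abs_nonneg _) (hσ' _)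
    · rw [pow_succ' 𝒜, Matrix.mul_apply, pow_succ, Finset.mul_sum, Finset.mul_sum]
      exact Finset.sum_congr rfl fun j _ => by ring

theorem norm_fderiv_pre_le (G : SimpleGraph (Fin n)) (hconn : G.Connected)
    (σ : ℝ → ℝ) (hσ : ContDiff ℝ 2 σ) (hσ' : ∀ x, |deriv σ x| ≤ 1)
    (𝒜 : Matrix (Fin n) (Fin n) ℝ)
    (hA : ∀ i j, 𝒜 i j ≠ 0 → G.Adj i j) (hA0 : ∀ i j, 0 ≤ 𝒜 i j)
    (Ω W : ℕ → EuclideanSpace ℝ (Fin d) →L[ℝ] EuclideanSpace ℝ (Fin d))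
    (w : ℝ) (hw : 0 < w) (hW : ∀ t, ‖W t‖ ≤ w)
    (ψ : ℕ → EuclideanSpace ℝ (Fin d) × EuclideanSpace ℝ (Fin d) → EuclideanSpace ℝ (Fin d))
    (hψ : ∀ t, ContDiff ℝ 2 (ψ t)) (c₂ : ℝ) (hc₂ : 0 < c₂)
    (hψ₂ : ∀ t x y, ‖fderiv ℝ (fun z => ψ t (x, z)) y‖ ≤ c₂)
    (a : Fin n) (ξ : EuclideanSpace ℝ (Fin d)) (hξ : ‖ξ‖ ≤ 1)
    (Y : Fin n → EuclideanSpace ℝ (Fin d)) (t : ℕ) (i : Fin n) (hi : t + 1 ≤ G.dist i a) :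
      ‖fderiv ℝ (fun X => pre σ 𝒜 Ω W ψ t X i) Y (sgl a ξ)‖
        ≤ (w * c₂) ^ (t+1) * (𝒜 ^ (t+1)) i a := by
  have h := norm_fderiv_pre_le_of G hconn σ hσ 𝒜 hA hA0 Ω W w hw hW ψ hψ c₂ hc₂ hψ₂ a ξ Y t
    _ (norm_fderiv_mpnn_le G hconn σ hσ hσ' 𝒜 hA hA0 Ω W w hw hW ψ hψ c₂ hc₂ hψ₂ a ξ hξ Y t) i hi
  refine h.trans (le_of_eq ?_)
  rw [pow_succ' 𝒜, Matrix.mul_apply, pow_succ, Finset.mul_sum, Finset.mul_sum]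
  exact Finset.sum_congr rfl fun j _ => by ring

theorem pre_separate (G : SimpleGraph (Fin n)) (hconn : G.Connected)
    (σ : ℝ → ℝ) (𝒜 : Matrix (Fin n) (Fin n) ℝ)
    (hA : ∀ i j, 𝒜 i j ≠ 0 → G.Adj i j)
    (Ω W : ℕ → EuclideanSpace ℝ (Fin d) →L[ℝ] EuclideanSpace ℝ (Fin d))
    (ψ : ℕ → EuclideanSpace ℝ (Fin d) × EuclideanSpace ℝ (Fin d) → EuclideanSpace ℝ (Fin d))
    (v u : Fin n) (ξ η : EuclideanSpace ℝ (Fin d)) (s τ : ℝ)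
    (Y : Fin n → EuclideanSpace ℝ (Fin d)) (t : ℕ) (hvu : G.dist v u = 2 * (t + 1))
    (i : Fin n) (hiv : t + 1 ≤ G.dist i v) (hiu : t + 1 ≤ G.dist i u) :
    pre σ 𝒜 Ω W ψ t (Y + s • sgl v ξ + τ • sgl u η) i
      = pre σ 𝒜 Ω W ψ t (Y + τ • sgl u η) i +
        (pre σ 𝒜 Ω W ψ t (Y + s • sgl v ξ) i - pre σ 𝒜 Ω W ψ t Y i) := by
  have lv : ∀ (Z : Fin n → EuclideanSpace ℝ (Fin d)) j, t < G.dist j v →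
      mpnn σ 𝒜 Ω W ψ t (Z + s • sgl v ξ) j = mpnn σ 𝒜 Ω W ψ t Z j := fun Z j hj =>
    mpnn_local G hconn σ 𝒜 hA Ω W ψ v ξ s Z t j hj
  have lu : ∀ (Z : Fin n → EuclideanSpace ℝ (Fin d)) j, t < G.dist j u →
      mpnn σ 𝒜 Ω W ψ t (Z + τ • sgl u η) j = mpnn σ 𝒜 Ω W ψ t Z j := fun Z j hj =>
    mpnn_local G hconn σ 𝒜 hA Ω W ψ u η τ Z t j hj
  simp only [pre]
  rw [lu _ i hiu, lu _ i hiu, lv _ i hiv]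
  rw [add_sub_add_left_eq_sub, add_assoc (Ω (t+1) (mpnn σ 𝒜 Ω W ψ t Y i)), ← map_sub, ← map_add, ← Finset.sum_sub_distrib,
    ← Finset.sum_add_distrib]
  congr 2
  refine Finset.sum_congr rfl fun j _ => ?_
  by_cases hj : t < G.dist j u
  · rw [lu _ j hj, lu _ j hj]; abel
  · have h2 : G.dist v u ≤ G.dist v j + G.dist j u := hconn.dist_triangle
    rw [SimpleGraph.dist_comm (u := v) (v := j)] at h2
    have hjv : t < G.dist j v := by omega
    rw [add_right_comm, lv _ j hjv, lv _ j hjv]; abel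

theorem abs_sum_mul_le (θ a b : EuclideanSpace ℝ (Fin d)) (k : Fin d → ℝ) (hθ : ‖θ‖ = 1)
    (hk : ∀ α, |k α| ≤ 1) : |∑ α, θ α * (k α * a α * b α)| ≤ ‖a‖ * ‖b‖ := by
  have hco : ∀ (x : EuclideanSpace ℝ (Fin d)) α, |x α| ≤ ‖x‖ := fun x α =>
    PiLp.norm_apply_le x α
  calc |∑ α, θ α * (k α * a α * b α)| ≤ ∑ α, |θ α * (k α * a α * b α)| :=
        Finset.abs_sum_le_sum_abs _ _
    _ ≤ ∑ α, |a α| * |b α| := by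
        refine Finset.sum_le_sum fun α _ => ?_
        have h1 := hco θ α
        rw [hθ] at h1
        rw [abs_mul, abs_mul, abs_mul]
        calc |θ α| * (|k α| * |a α| * |b α|) ≤ 1 * (1 * |a α| * |b α|) := by
              gcongr
              exact hk α
          _ = _ := by ring
    _ ≤ Real.sqrt (∑ α, |a α| ^ 2) * Real.sqrt (∑ α, |b α| ^ 2) :=
        Real.sum_mul_le_sqrt_mul_sqrt _ _ _
    _ = ‖a‖ * ‖b‖ := by
        simp [EuclideanSpace.norm_eq]

/-- contribution of node `i` to the readout. -/
def part (θ : EuclideanSpace ℝ (Fin d)) (σ : ℝ → ℝ) (𝒜 : Matrix (Fin n) (Fin n) ℝ)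
    (Ω W : ℕ → EuclideanSpace ℝ (Fin d) →L[ℝ] EuclideanSpace ℝ (Fin d))
    (ψ : ℕ → EuclideanSpace ℝ (Fin d) × EuclideanSpace ℝ (Fin d) → EuclideanSpace ℝ (Fin d))
    (m : ℕ) (i : Fin n) (X : Fin n → EuclideanSpace ℝ (Fin d)) : ℝ :=
  ∑ α : Fin d, θ α * mpnn σ 𝒜 Ω W ψ m X i α

theorem contDiff_part (θ : EuclideanSpace ℝ (Fin d)) (σ : ℝ → ℝ) (hσ : ContDiff ℝ 2 σ)
    (𝒜 : Matrix (Fin n) (Fin n) ℝ)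
    (Ω W : ℕ → EuclideanSpace ℝ (Fin d) →L[ℝ] EuclideanSpace ℝ (Fin d))
    (ψ : ℕ → EuclideanSpace ℝ (Fin d) × EuclideanSpace ℝ (Fin d) → EuclideanSpace ℝ (Fin d))
    (hψ : ∀ t, ContDiff ℝ 2 (ψ t)) (m : ℕ) (i : Fin n) :
    ContDiff ℝ 2 (part θ σ 𝒜 Ω W ψ m i) := by
  unfold part
  refine ContDiff.sum fun α _ => contDiff_const.mul ?_
  exact contDiff_euclidean.mp (contDiff_mpnn σ hσ 𝒜 Ω W ψ hψ m i) α

theorem part_hess_le (G : SimpleGraph (Fin n)) (hconn : G.Connected)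
    (σ : ℝ → ℝ) (hσ : ContDiff ℝ 2 σ)
    (hσ' : ∀ x, |deriv σ x| ≤ 1) (hσ'' : ∀ x, |deriv (deriv σ) x| ≤ 1)
    (𝒜 : Matrix (Fin n) (Fin n) ℝ)
    (hA : ∀ i j, 𝒜 i j ≠ 0 → G.Adj i j) (hA0 : ∀ i j, 0 ≤ 𝒜 i j)
    (Ω W : ℕ → EuclideanSpace ℝ (Fin d) →L[ℝ] EuclideanSpace ℝ (Fin d))
    (w : ℝ) (hw : 0 < w) (hW : ∀ t, ‖W t‖ ≤ w)
    (ψ : ℕ → EuclideanSpace ℝ (Fin d) × EuclideanSpace ℝ (Fin d) → EuclideanSpace ℝ (Fin d))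
    (hψ : ∀ t, ContDiff ℝ 2 (ψ t)) (c₂ : ℝ) (hc₂ : 0 < c₂)
    (hψ₂ : ∀ t x y, ‖fderiv ℝ (fun z => ψ t (x, z)) y‖ ≤ c₂)
    (θ : EuclideanSpace ℝ (Fin d)) (hθ : ‖θ‖ = 1)
    (v u : Fin n) (ξ η : EuclideanSpace ℝ (Fin d)) (hξ : ‖ξ‖ ≤ 1) (hη : ‖η‖ ≤ 1)
    (X : Fin n → EuclideanSpace ℝ (Fin d)) (t : ℕ) (hvu : G.dist v u = 2 * (t + 1))
    (i : Fin n) :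
    |fderiv ℝ (fun Y => fderiv ℝ (part θ σ 𝒜 Ω W ψ (t+1) i) Y (sgl u η)) X
        (sgl v ξ)| ≤
      ((w * c₂) ^ (t+1) * (𝒜 ^ (t+1)) i v) * ((w * c₂) ^ (t+1) * (𝒜 ^ (t+1)) i u) := by
  have hC := contDiff_part θ σ hσ 𝒜 Ω W ψ hψ (t+1) i
  have hpow : ∀ k i j, 0 ≤ (𝒜 ^ k) i j := by
    intro k
    induction k with
    | zero => intro i j; rw [pow_zero, Matrix.one_apply]; split_ifs <;> norm_num
    | succ k ih =>
      intro i j; rw [pow_succ, Matrix.mul_apply]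
      exact Finset.sum_nonneg fun l _ => mul_nonneg (ih _ _) (hA0 _ _)
  have hrhs : 0 ≤ ((w * c₂) ^ (t+1) * (𝒜 ^ (t+1)) i v) * ((w * c₂) ^ (t+1) * (𝒜 ^ (t+1)) i u) := by
    have := hpow (t+1) i v
    have := hpow (t+1) i u
    positivity
  have hCd : Differentiable ℝ (part θ σ 𝒜 Ω W ψ (t+1) i) := hC.differentiable (by norm_num)
  have hD : Differentiable ℝ (fun Y => fderiv ℝ (part θ σ 𝒜 Ω W ψ (t+1) i) Y (sgl u η)) := by
    have h1 : ContDiff ℝ 1 (fderiv ℝ (part θ σ 𝒜 Ω W ψ (t+1) i)) :=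
      hC.fderiv_right (by norm_num)
    exact (h1.differentiable (by norm_num)).clm_apply (differentiable_const _)
  have hline := hasDerivAt_line (hD X) (sgl v ξ)
  by_cases hu : t + 1 < G.dist i u
  · have hz : (fun Y => fderiv ℝ (part θ σ 𝒜 Ω W ψ (t+1) i) Y (sgl u η)) = fun _ => 0 := by
      funext Y
      have h1 := hasDerivAt_line (hCd Y) (sgl u η)
      have h2 : (fun s : ℝ => part θ σ 𝒜 Ω W ψ (t+1) i (Y + s • sgl u η))
          = fun _ => part θ σ 𝒜 Ω W ψ (t+1) i Y := by
        funext s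
        simp only [part, mpnn_local G hconn σ 𝒜 hA Ω W ψ u η s Y (t+1) i hu]
      rw [h2] at h1
      exact h1.unique (hasDerivAt_const _ _)
    rw [hz]
    simpa using hrhs
  by_cases hv : t + 1 < G.dist i v
  · have hz : (fun s : ℝ => fderiv ℝ (part θ σ 𝒜 Ω W ψ (t+1) i) (X + s • sgl v ξ)
        (sgl u η)) = fun _ => fderiv ℝ (part θ σ 𝒜 Ω W ψ (t+1) i) X (sgl u η) := by
      funext s
      have h1 := hasDerivAt_line (hCd X) (sgl u η)
      have h2 := hasDerivAt_line (hCd (X + s • sgl v ξ)) (sgl u η)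
      have h3 : (fun τ : ℝ => part θ σ 𝒜 Ω W ψ (t+1) i
            (X + s • sgl v ξ + τ • sgl u η))
          = fun τ : ℝ => part θ σ 𝒜 Ω W ψ (t+1) i (X + τ • sgl u η) := by
        funext τ
        rw [add_right_comm]
        simp only [part, mpnn_local G hconn σ 𝒜 hA Ω W ψ v ξ s _ (t+1) i hv]
      rw [h3] at h2
      exact h2.unique h1
    rw [hz] at hline
    rw [hline.unique (hasDerivAt_const _ _)]
    simpa using hrhs
  have h2 : G.dist v u ≤ G.dist v i + G.dist i u := hconn.dist_triangle
  rw [SimpleGraph.dist_comm (u := v) (v := i)] at h2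
  have hiv : t + 1 ≤ G.dist i v := by omega
  have hiu : t + 1 ≤ G.dist i u := by omega
  have hpd : Differentiable ℝ (fun Y => pre σ 𝒜 Ω W ψ t Y i) :=
    (contDiff_pre σ hσ 𝒜 Ω W ψ hψ t i).differentiable (by norm_num)
  set P : (Fin n → EuclideanSpace ℝ (Fin d)) → EuclideanSpace ℝ (Fin d) :=
    fun Y => pre σ 𝒜 Ω W ψ t Y i with hP
  set a := fderiv ℝ P X (sgl v ξ) with ha
  set b := fderiv ℝ P X (sgl u η) with hb
  have hbconst : ∀ s : ℝ, fderiv ℝ P (X + s • sgl v ξ) (sgl u η) = b := by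
    intro s
    have h1 := hasDerivAt_line (hpd X) (sgl u η)
    have h2 := hasDerivAt_line (hpd (X + s • sgl v ξ)) (sgl u η)
    have h3 : (fun τ : ℝ => P (X + s • sgl v ξ + τ • sgl u η))
        = fun τ : ℝ => P (X + τ • sgl u η) + (P (X + s • sgl v ξ) - P X) := by
      funext τ
      exact pre_separate G hconn σ 𝒜 hA Ω W ψ v u ξ η s τ X t hvu i hiv hiu
    rw [h3] at h2
    exact h2.unique (h1.add_const _)
  have hmd : Differentiable ℝ (fun Y => mpnn σ 𝒜 Ω W ψ (t+1) Y i) :=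
    (contDiff_mpnn σ hσ 𝒜 Ω W ψ hψ (t+1) i).differentiable (by norm_num)
  have hpart : ∀ Y e, fderiv ℝ (part θ σ 𝒜 Ω W ψ (t+1) i) Y e
      = ∑ α, θ α * (deriv σ (P Y α) * fderiv ℝ P Y e α) := by
    intro Y e
    have h1 : HasFDerivAt (part θ σ 𝒜 Ω W ψ (t+1) i)
        (∑ α, θ α • fderiv ℝ (fun Z => mpnn σ 𝒜 Ω W ψ (t+1) Z i α) Y) Y := by
      unfold part
      refine HasFDerivAt.fun_sum fun α _ => ?_
      exact ((differentiableAt_euclidean.mp (hmd Y)) α).hasFDerivAt.const_mul (θ α)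
    rw [h1.fderiv, sum_apply]
    refine Finset.sum_congr rfl fun α _ => ?_
    rw [ContinuousLinearMap.smul_apply, smul_eq_mul, fderiv_coord (hmd Y),
      fderiv_mpnn_coord σ hσ 𝒜 Ω W ψ hψ]
  have hσ1 : Differentiable ℝ (deriv σ) := by
    have : ContDiff ℝ 1 (deriv σ) := by
      have h : ContDiff ℝ (1 + 1) σ := by
        have : (1 + 1 : WithTop ℕ∞) = 2 := by norm_num
        rw [this]; exact hσ
      exact (contDiff_succ_iff_deriv.mp h).2.2
    exact this.differentiable (by norm_num)
  have hline2 : HasDerivAt (fun s : ℝ => fderiv ℝ (part θ σ 𝒜 Ω W ψ (t+1) i)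
      (X + s • sgl v ξ) (sgl u η))
      (∑ α, θ α * (deriv (deriv σ) (P X α) * a α * b α)) 0 := by
    have heq : (fun s : ℝ => fderiv ℝ (part θ σ 𝒜 Ω W ψ (t+1) i)
      (X + s • sgl v ξ) (sgl u η)) =
        fun s : ℝ => ∑ α, θ α * (deriv σ (P (X + s • sgl v ξ) α) * b α) := by
      funext s
      rw [hpart]
      simp only [hbconst s]
    rw [heq]
    refine HasDerivAt.fun_sum fun α _ => HasDerivAt.const_mul _ (HasDerivAt.mul_const ?_ _)
    have hPc : DifferentiableAt ℝ (fun Y => P Y α) X := (differentiableAt_euclidean.mp (hpd X)) α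
    have h1 := hasDerivAt_line hPc (sgl v ξ)
    rw [fderiv_coord (hpd X)] at h1
    exact HasDerivAt.comp_of_eq (0:ℝ) (hσ1 (P X α)).hasDerivAt h1 (by simp)
  rw [hline.unique hline2]
  refine (abs_sum_mul_le θ a b _ hθ fun α => hσ'' _).trans ?_
  exact mul_le_mul
    (norm_fderiv_pre_le G hconn σ hσ hσ' 𝒜 hA hA0 Ω W w hw hW ψ hψ c₂ hc₂ hψ₂ v ξ hξ X t i hiv)
    (norm_fderiv_pre_le G hconn σ hσ hσ' 𝒜 hA hA0 Ω W w hw hW ψ hψ c₂ hc₂ hψ₂ u η hη X t i hiu)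
    (norm_nonneg _) (by have := hpow (t+1) i v; positivity)

theorem Asym_apply (G : SimpleGraph (Fin n)) [DecidableRel G.Adj] (i j : Fin n) :
    Asym G i j = (Real.sqrt (G.degree i))⁻¹ * G.adjMatrix ℝ i j * (Real.sqrt (G.degree j))⁻¹ := by
  rw [Asym, Matrix.mul_diagonal, Matrix.diagonal_mul]

theorem Asym_nonneg (G : SimpleGraph (Fin n)) [DecidableRel G.Adj] (i j : Fin n) :
    0 ≤ Asym G i j := by
  rw [Asym_apply, SimpleGraph.adjMatrix_apply]
  split_ifs <;> positivity

theorem Asym_adj (G : SimpleGraph (Fin n)) [DecidableRel G.Adj] (i j : Fin n)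
    (h : Asym G i j ≠ 0) : G.Adj i j := by
  by_contra hc
  apply h
  rw [Asym_apply, SimpleGraph.adjMatrix_apply, if_neg hc]
  simp

theorem Asym_symm_pow (G : SimpleGraph (Fin n)) [DecidableRel G.Adj] (k : ℕ) (i j : Fin n) :
    (Asym G ^ k) i j = (Asym G ^ k) j i := by
  have h : (Asym G).transpose = Asym G := by
    ext a b
    rw [Matrix.transpose_apply, Asym_apply, Asym_apply, SimpleGraph.adjMatrix_apply,
      SimpleGraph.adjMatrix_apply]
    simp only [G.adj_comm b a]
    ring
  conv_rhs => rw [← h, ← Matrix.transpose_pow]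
  rfl

theorem Asym_pow_le (G : SimpleGraph (Fin n)) [DecidableRel G.Adj] (hd : 0 < G.minDegree)
    (k : ℕ) : ∀ i j, (Asym G ^ k) i j ≤ ((G.minDegree : ℝ)⁻¹) ^ k * (G.adjMatrix ℝ ^ k) i j := by
  have hd' : (0:ℝ) < G.minDegree := by exact_mod_cast hd
  have h1 : ∀ i j, Asym G i j ≤ (G.minDegree : ℝ)⁻¹ * G.adjMatrix ℝ i j := by
    intro i j
    have hs : ∀ a, (Real.sqrt (G.degree a))⁻¹ ≤ (Real.sqrt G.minDegree)⁻¹ := fun a =>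
      inv_anti₀ (Real.sqrt_pos.mpr hd')
        (Real.sqrt_le_sqrt (by exact_mod_cast G.minDegree_le_degree a))
    have hm : (Real.sqrt G.minDegree)⁻¹ * (Real.sqrt G.minDegree)⁻¹ = (G.minDegree : ℝ)⁻¹ := by
      rw [← mul_inv, Real.mul_self_sqrt hd'.le]
    have ha : 0 ≤ G.adjMatrix ℝ i j := by
      rw [SimpleGraph.adjMatrix_apply]; split_ifs <;> norm_num
    rw [Asym_apply, ← hm]
    calc _ = ((Real.sqrt (G.degree i))⁻¹ * (Real.sqrt (G.degree j))⁻¹) * G.adjMatrix ℝ i j := by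
          ring
      _ ≤ _ := by
          refine mul_le_mul_of_nonneg_right ?_ ha
          exact mul_le_mul (hs i) (hs j) (by positivity) (by positivity)
  induction k with
  | zero => intro i j; simp
  | succ k ih =>
    intro i j
    rw [pow_succ, Matrix.mul_apply, pow_succ (G.adjMatrix ℝ), Matrix.mul_apply, Finset.mul_sum]
    refine Finset.sum_le_sum fun l _ => ?_
    have hnn : 0 ≤ (G.adjMatrix ℝ ^ k) i l := by
      rw [SimpleGraph.adjMatrix_pow_apply_eq_card_walk]; positivity
    calc _ ≤ (((G.minDegree : ℝ)⁻¹) ^ k * (G.adjMatrix ℝ ^ k) i l) *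
          ((G.minDegree : ℝ)⁻¹ * G.adjMatrix ℝ l j) :=
          mul_le_mul (ih i l) (h1 l j) (Asym_nonneg G l j) (by positivity)
      _ = _ := by ring

/-- Theorem 4.1 for `𝒜 = A_sym`: lower bound on the weight norm
needed to generate mixing `M` at minimal depth `m = r/2`. -/
theorem weight_lower_bound_sym [Nonempty (Fin n)]
    (G : SimpleGraph (Fin n)) [DecidableRel G.Adj] (hconn : G.Connected)
    (σ : ℝ → ℝ) (hσ : ContDiff ℝ 2 σ)
    (hσ' : ∀ x, |deriv σ x| ≤ 1) (hσ'' : ∀ x, |deriv (deriv σ) x| ≤ 1)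
    (Ω W : ℕ → EuclideanSpace ℝ (Fin d) →L[ℝ] EuclideanSpace ℝ (Fin d))
    (ω w : ℝ) (hw : 0 < w) (hΩ : ∀ t, ‖Ω t‖ ≤ ω) (hW : ∀ t, ‖W t‖ ≤ w)
    (ψ : ℕ → EuclideanSpace ℝ (Fin d) × EuclideanSpace ℝ (Fin d) → EuclideanSpace ℝ (Fin d))
    (hψ : ∀ t, ContDiff ℝ 2 (ψ t)) (c₁ c₂ c2 : ℝ) (hc₂ : 0 < c₂)
    (hψ₁ : ∀ t x y, ‖fderiv ℝ (fun z => ψ t (z, y)) x‖ ≤ c₁)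
    (hψ₂ : ∀ t x y, ‖fderiv ℝ (fun z => ψ t (x, z)) y‖ ≤ c₂)
    (hψ₃ : ∀ t p, ‖iteratedFDeriv ℝ 2 (ψ t) p‖ ≤ c2)
    (θ : EuclideanSpace ℝ (Fin d)) (hθ : ‖θ‖ = 1)
    (v u : Fin n) (r : ℕ) (hr : r = G.dist v u) (hrpos : 0 < r) (hreven : Even r)
    (q : ℕ) (hq : q = {p : G.Walk v u | p.length = r ∧ p.IsPath}.ncard) (hq1 : 1 ≤ q)
    (m : ℕ) (hm : m = r / 2)
    (M : ℝ) (hM : 0 < M)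
    (X : Fin n → EuclideanSpace ℝ (Fin d)) (α β : Fin d)
    (hmix : M ≤ |OSQ.mixEntry θ σ (Asym G) Ω W ψ m v u X α β|) :
    (G.minDegree : ℝ) / c₂ * (M / q) ^ ((1 : ℝ) / r) ≤ w := by
  obtain ⟨k, hk⟩ := hreven
  obtain ⟨t, rfl⟩ : ∃ t, m = t + 1 := ⟨m - 1, by omega⟩
  have hvu : G.dist v u = 2 * (t + 1) := by omega
  have hr2 : r = (t + 1) + (t + 1) := by omega
  have hne : v ≠ u := by rintro rfl; simp at hvu
  have : Nontrivial (Fin n) := ⟨v, u, hne⟩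
  have hdeg : 0 < G.minDegree := hconn.preconnected.minDegree_pos_of_nontrivial
  have hdeg' : (0:ℝ) < G.minDegree := by exact_mod_cast hdeg
  have hA := Asym_adj G
  have hA0 := Asym_nonneg G
  have hread : (fun Z => readout θ σ (Asym G) Ω W ψ (t+1) Z)
      = fun Z => ∑ i, part θ σ (Asym G) Ω W ψ (t+1) i Z := by
    funext Z
    simp only [readout, part]
    rw [Finset.sum_comm]
    refine Finset.sum_congr rfl fun γ _ => ?_
    rw [WithLp.ofLp_sum, Finset.sum_apply, Finset.mul_sum]
  have hC := fun i => contDiff_part θ σ hσ (Asym G) Ω W ψ hψ (t+1) i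
  have hCd := fun i => (hC i).differentiable (by norm_num : (2 : WithTop ℕ∞) ≠ 0)
  have hD : ∀ i, Differentiable ℝ
      (fun Y => fderiv ℝ (part θ σ (Asym G) Ω W ψ (t+1) i) Y (dir u β)) := by
    intro i
    have h1 : ContDiff ℝ 1 (fderiv ℝ (part θ σ (Asym G) Ω W ψ (t+1) i)) :=
      (hC i).fderiv_right (by norm_num)
    exact (h1.differentiable (by norm_num)).clm_apply (differentiable_const _)
  have hmixeq : mixEntry θ σ (Asym G) Ω W ψ (t+1) v u X α β
      = ∑ i, fderiv ℝ (fun Y => fderiv ℝ (part θ σ (Asym G) Ω W ψ (t+1) i) Y (dir u β)) X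
          (dir v α) := by
    unfold mixEntry
    rw [hread]
    have h1 : (fun Y => fderiv ℝ (fun Z => ∑ i, part θ σ (Asym G) Ω W ψ (t+1) i Z) Y (dir u β))
        = fun Y => ∑ i, fderiv ℝ (part θ σ (Asym G) Ω W ψ (t+1) i) Y (dir u β) := by
      funext Y
      rw [(HasFDerivAt.fun_sum fun i _ => (hCd i Y).hasFDerivAt).fderiv,
        sum_apply]
    rw [h1, (HasFDerivAt.fun_sum fun i _ => (hD i X).hasFDerivAt).fderiv,
      sum_apply]
  have hbound : |mixEntry θ σ (Asym G) Ω W ψ (t+1) v u X α β|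
      ≤ (w * c₂) ^ r * (Asym G ^ r) v u := by
    rw [hmixeq]
    refine (Finset.abs_sum_le_sum_abs _ _).trans ?_
    refine (Finset.sum_le_sum fun i _ => part_hess_le G hconn σ hσ hσ' hσ'' (Asym G) hA hA0 Ω W w
      hw hW ψ hψ c₂ hc₂ hψ₂ θ hθ v u (EuclideanSpace.single α 1) (EuclideanSpace.single β 1)
      (by simp) (by simp) X t hvu i).trans (le_of_eq ?_)
    rw [hr2, pow_add (Asym G) (t+1) (t+1), pow_add (w * c₂) (t+1) (t+1), Matrix.mul_apply, Finset.mul_sum]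
    refine Finset.sum_congr rfl fun i _ => ?_
    rw [Asym_symm_pow G (t+1) i v]
    ring
  have hcard : (G.adjMatrix ℝ ^ r) v u = q := by
    rw [SimpleGraph.adjMatrix_pow_apply_eq_card_walk, hq]
    have hset : {p : G.Walk v u | p.length = r ∧ p.IsPath} = {p : G.Walk v u | p.length = r} := by
      ext p
      simp only [Set.mem_setOf_eq, and_iff_left_iff_imp]
      intro hp
      exact p.isPath_of_length_eq_dist (hp.trans hr)
    rw [hset, ← Nat.card_coe_set_eq, Nat.card_eq_fintype_card]
  have hq0 : (0:ℝ) < q := by exact_mod_cast hq1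
  have hfin : M / q ≤ (w * c₂ / G.minDegree) ^ r := by
    rw [div_le_iff₀ hq0]
    calc M ≤ (w * c₂) ^ r * (Asym G ^ r) v u := hmix.trans hbound
      _ ≤ (w * c₂) ^ r * (((G.minDegree : ℝ)⁻¹) ^ r * q) := by
          rw [← hcard]
          exact mul_le_mul_of_nonneg_left (Asym_pow_le G hdeg r v u) (by positivity)
      _ = _ := by rw [div_eq_mul_inv, mul_pow _ (G.minDegree : ℝ)⁻¹]; ring
  have hroot : (M / q) ^ ((1:ℝ) / r) ≤ w * c₂ / G.minDegree := by
    have h1 := Real.rpow_le_rpow (by positivity) hfin (by positivity : (0:ℝ) ≤ 1 / r)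
    refine h1.trans (le_of_eq ?_)
    rw [one_div, Real.pow_rpow_inv_natCast (by positivity) hrpos.ne']
  calc (G.minDegree : ℝ) / c₂ * (M / q) ^ ((1:ℝ) / r)
      ≤ (G.minDegree : ℝ) / c₂ * (w * c₂ / G.minDegree) :=
        mul_le_mul_of_nonneg_left hroot (by positivity)
    _ = w := by field_simp
end OSQ
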